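/- arXiv:2103.02110 — 2 statements merged into one kernel-verified Lean document; each statement's English description precedes it below -/
import Mathlib

section
/- Under the Paillier setup, Paillier encryption is additively homomorphic: for plaintexts m₁, m₂ : ℕ with m₁ + m₂ < n and units r₁, r₂ of ZMod (n^2), decrypting the product of the two ciphertexts yields the sum of the plaintexts, i.e. D(E(m₁, r₁) · E(m₂, r₂)) = m₁ + m₂. -/
/-- Paillier encryption of the plaintext `m : ℕ` with randomness a unit `r` of
`ZMod (n ^ 2)`: `E(m, r) = (1 + n) ^ m * r ^ n` in `ZMod (n ^ 2)`. -/
def paillierEnc (n : ℕ) (m : ℕ) (r : (ZMod (n ^ 2))ˣ) : ZMod (n ^ 2) :=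
  (1 + (n : ZMod (n ^ 2))) ^ m * (r : ZMod (n ^ 2)) ^ n

/-- Paillier decryption of the ciphertext `c : ZMod (n ^ 2)`:
`D(c) = (((c ^ λ).val - 1) / n * μ) % n`. -/
def paillierDec (n lam μ : ℕ) (c : ZMod (n ^ 2)) : ℕ :=
  ((c ^ lam).val - 1) / n * μ % n

theorem paillier_aux_modEq (p N x : ℕ) (hp : p.Prime) (hx : x.Coprime p)
    (h : p * (p - 1) ∣ N) : x ^ N ≡ 1 [MOD p ^ 2] := by
  obtain ⟨k, rfl⟩ := h
  have h1 : x ^ Nat.totient (p ^ 2) ≡ 1 [MOD p ^ 2] :=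
    Nat.ModEq.pow_totient (Nat.Coprime.pow_right 2 hx)
  rw [Nat.totient_prime_pow hp (by norm_num)] at h1
  have h2 := h1.pow k
  simpa [pow_mul] using h2

theorem paillier_aux_unit (p q : ℕ) (hp : p.Prime) (hq : q.Prime) (hpq : p ≠ q)
    (r : (ZMod ((p * q) ^ 2))ˣ) :
    (r : ZMod ((p * q) ^ 2)) ^ (p * q * Nat.lcm (p - 1) (q - 1)) = 1 := by
  have hpos : 0 < p * q := Nat.mul_pos hp.pos hq.pos
  have : NeZero ((p * q) ^ 2) := ⟨by positivity⟩
  have hc := ZMod.val_coe_unit_coprime r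
  have hc' : Nat.Coprime (r : ZMod ((p * q) ^ 2)).val (p * q) :=
    Nat.Coprime.coprime_dvd_right (dvd_pow_self _ (by norm_num)) hc
  have h1 := paillier_aux_modEq p (p * q * Nat.lcm (p - 1) (q - 1)) _ hp
    (Nat.Coprime.coprime_dvd_right (dvd_mul_right p q) hc')
    (mul_dvd_mul (dvd_mul_right p q) (Nat.dvd_lcm_left _ _))
  have h2 := paillier_aux_modEq q (p * q * Nat.lcm (p - 1) (q - 1)) _ hq
    (Nat.Coprime.coprime_dvd_right (dvd_mul_left q p) hc')
    (mul_dvd_mul (dvd_mul_left q p) (Nat.dvd_lcm_right _ _))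
  have hcop : Nat.Coprime (p ^ 2) (q ^ 2) :=
    Nat.Coprime.pow 2 2 ((Nat.coprime_primes hp hq).2 hpq)
  have h3 := (Nat.modEq_and_modEq_iff_modEq_mul hcop).1 ⟨h1, h2⟩
  rw [← mul_pow, ← ZMod.natCast_eq_natCast_iff] at h3
  simpa using h3

theorem paillier_aux_pow (n k : ℕ) :
    (1 + (n : ZMod (n ^ 2))) ^ k = 1 + (k : ZMod (n ^ 2)) * n := by
  have h0 : (n : ZMod (n ^ 2)) * n = 0 := by
    have := ZMod.natCast_self (n ^ 2)
    push_cast at this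
    rw [← this]; ring
  induction k with
  | zero => simp
  | succ k ih =>
    rw [pow_succ (1 + (n : ZMod (n ^ 2))) k, ih]
    push_cast
    linear_combination (k : ZMod (n ^ 2)) * h0

theorem paillier_additively_homomorphic (p q : ℕ) (hp : p.Prime) (hq : q.Prime)
    (hpq : p ≠ q) (hgcd : Nat.gcd (p * q) ((p - 1) * (q - 1)) = 1)
    (n lam μ : ℕ) (hn : n = p * q) (hlam : lam = Nat.lcm (p - 1) (q - 1))
    (hμ : μ * lam ≡ 1 [MOD n])
    (m₁ m₂ : ℕ) (hm : m₁ + m₂ < n) (r₁ r₂ : (ZMod (n ^ 2))ˣ) :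
    paillierDec n lam μ (paillierEnc n m₁ r₁ * paillierEnc n m₂ r₂) = m₁ + m₂ := by
  have hn2 : 2 ≤ n := by
    rw [hn]; nlinarith [hp.two_le, hq.two_le]
  have hr : ∀ r : (ZMod (n ^ 2))ˣ, (r : ZMod (n ^ 2)) ^ (n * lam) = 1 := by
    subst hn hlam
    exact paillier_aux_unit p q hp hq hpq
  have hc : (paillierEnc n m₁ r₁ * paillierEnc n m₂ r₂) ^ lam
      = ((1 + ((m₁ + m₂) * lam % n) * n : ℕ) : ZMod (n ^ 2)) := by
    have e1 : (paillierEnc n m₁ r₁ * paillierEnc n m₂ r₂) ^ lam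
        = (1 + (n : ZMod (n ^ 2))) ^ ((m₁ + m₂) * lam) := by
      unfold paillierEnc
      calc _ = (1 + (n : ZMod (n ^ 2))) ^ ((m₁ + m₂) * lam)
            * ((r₁ : ZMod (n ^ 2)) ^ (n * lam) * (r₂ : ZMod (n ^ 2)) ^ (n * lam)) := by
              simp only [mul_pow, pow_mul, pow_add]; ring
        _ = _ := by rw [hr, hr]; simp
    rw [e1, paillier_aux_pow]
    have : ((1 + (m₁ + m₂) * lam * n : ℕ) : ZMod (n ^ 2))
        = ((1 + ((m₁ + m₂) * lam % n) * n : ℕ) : ZMod (n ^ 2)) := by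
      rw [ZMod.natCast_eq_natCast_iff, sq]
      exact Nat.ModEq.add_left 1 ((Nat.mod_modEq _ _).symm.mul_right' n)
    rw [← this]; push_cast; ring
  have hk : (m₁ + m₂) * lam % n < n := Nat.mod_lt _ (by omega)
  have hlt : 1 + (m₁ + m₂) * lam % n * n < n ^ 2 := by
    generalize (m₁ + m₂) * lam % n = k at hk
    nlinarith [Nat.mul_le_mul_right n (Nat.succ_le_of_lt hk)]
  unfold paillierDec
  rw [hc, ZMod.val_natCast, Nat.mod_eq_of_lt hlt, Nat.add_sub_cancel_left,
    Nat.mul_div_cancel _ (by omega)]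
  have h1 : (m₁ + m₂) * lam % n * μ ≡ m₁ + m₂ [MOD n] := by
    calc (m₁ + m₂) * lam % n * μ ≡ (m₁ + m₂) * lam * μ [MOD n] :=
          (Nat.mod_modEq _ _).mul_right μ
      _ = (m₁ + m₂) * (μ * lam) := by ring
      _ ≡ (m₁ + m₂) * 1 [MOD n] := hμ.mul_left _
      _ = m₁ + m₂ := mul_one _
  rw [h1, Nat.mod_eq_of_lt hm]
end

section
/- Under the Paillier setup, the masked aggregation step of Paradigm 1 is correct: let k agents hold values a : Fin k → ZMod n, let the system operator choose masks γ : Fin k → ZMod n with ∑ᵢ γ i = 1 and a global value c : ZMod n, and let each agent i encrypt the ZMod n element a i + γ i · c (via its canonical representative (a i + γ i · c).val) with an arbitrary unit rᵢ of ZMod (n^2). Then the decryption of the product of all k ciphertexts, cast back into ZMod n, equals (∑ᵢ a i) + c. -/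
theorem paillier_unit_pow (p q : ℕ) (hp : p.Prime) (hq : q.Prime) (hpq : p ≠ q)
    (R : (ZMod ((p * q) ^ 2))ˣ) :
    R ^ ((p * q) * Nat.lcm (p - 1) (q - 1)) = 1 := by
  have hn0 : (p * q) ^ 2 ≠ 0 := pow_ne_zero _ (mul_ne_zero hp.ne_zero hq.ne_zero)
  have : NeZero ((p * q) ^ 2) := ⟨hn0⟩
  set x := (R : ZMod ((p * q) ^ 2)).val with hx
  have hcop : Nat.Coprime x ((p * q) ^ 2) := ZMod.val_coe_unit_coprime R
  have hxR : ((x : ℕ) : ZMod ((p * q) ^ 2)) = R := ZMod.natCast_zmod_val _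
  have key : ∀ s : ℕ, s.Prime → s ∣ p * q → (s - 1) ∣ Nat.lcm (p - 1) (q - 1) →
      x ^ ((p * q) * Nat.lcm (p - 1) (q - 1)) ≡ 1 [MOD s ^ 2] := by
    intro s hs h1 h2
    have hc : Nat.Coprime x (s ^ 2) := hcop.coprime_dvd_right (pow_dvd_pow_of_dvd h1 2)
    have ht := Nat.ModEq.pow_totient hc
    have hd : Nat.totient (s ^ 2) ∣ (p * q) * Nat.lcm (p - 1) (q - 1) := by
      rw [Nat.totient_prime_pow hs (by norm_num)]
      simpa using mul_dvd_mul h1 h2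
    obtain ⟨t, ht'⟩ := hd
    rw [ht', pow_mul]
    simpa using ht.pow t
  have h1 := key p hp (dvd_mul_right _ _) (Nat.dvd_lcm_left _ _)
  have h2 := key q hq (dvd_mul_left _ _) (Nat.dvd_lcm_right _ _)
  have hcpq : Nat.Coprime (p ^ 2) (q ^ 2) :=
    Nat.Coprime.pow 2 2 ((Nat.coprime_primes hp hq).2 hpq)
  have h3 := (Nat.modEq_and_modEq_iff_modEq_mul hcpq).1 ⟨h1, h2⟩
  rw [← mul_pow] at h3
  have h4 := (ZMod.natCast_eq_natCast_iff _ _ _).2 h3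
  ext
  push_cast at h4 ⊢
  rw [hxR] at h4
  exact h4

theorem paillier_one_add_pow (n K : ℕ) :
    (1 + (n : ZMod (n ^ 2))) ^ K = 1 + (n : ZMod (n ^ 2)) * K := by
  have h0 : (n : ZMod (n ^ 2)) * n = 0 := by
    have := ZMod.natCast_self (n ^ 2)
    rw [← this]; push_cast; ring
  induction K with
  | zero => simp
  | succ K ih =>
    rw [pow_succ (1 + (n : ZMod (n ^ 2))) K, ih]
    push_cast
    linear_combination (K : ZMod (n ^ 2)) * h0

theorem paillier_val (n K : ℕ) (hn : 1 < n) :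
    ((1 + (n : ZMod (n ^ 2)) * K).val - 1) / n = K % n := by
  have h0 : (n : ZMod (n ^ 2)) * n = 0 := by
    have := ZMod.natCast_self (n ^ 2)
    rw [← this]; push_cast; ring
  have h : (1 + (n : ZMod (n ^ 2)) * K) = ((1 + n * (K % n) : ℕ) : ZMod (n ^ 2)) := by
    conv_lhs => rw [← Nat.mod_add_div K n]
    push_cast
    linear_combination ((K / n : ℕ) : ZMod (n ^ 2)) * h0
  have hlt : 1 + n * (K % n) < n ^ 2 := by
    have : K % n < n := Nat.mod_lt _ (by omega)
    nlinarith
  rw [h, ZMod.val_natCast_of_lt hlt, Nat.add_sub_cancel_left, Nat.mul_div_cancel_left _ (by omega)]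

theorem paradigm_masked_aggregation_correct (p q : ℕ) (hp : p.Prime) (hq : q.Prime)
    (hpq : p ≠ q) (hgcd : Nat.gcd (p * q) ((p - 1) * (q - 1)) = 1)
    (n lam μ : ℕ) (hn : n = p * q) (hlam : lam = Nat.lcm (p - 1) (q - 1))
    (hμ : μ * lam ≡ 1 [MOD n])
    (k : ℕ) (a : Fin k → ZMod n) (γ : Fin k → ZMod n) (hγ : ∑ i, γ i = 1)
    (c : ZMod n) (r : Fin k → (ZMod (n ^ 2))ˣ) :
    ((paillierDec n lam μ
        (∏ i, paillierEnc n ((a i + γ i * c).val) (r i)) : ZMod n)) =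
      (∑ i, a i) + c := by
  have hn1 : 1 < n := by
    rw [hn]; nlinarith [hp.two_le, hq.two_le]
  have : NeZero n := ⟨by omega⟩
  have hR : ((∏ i, r i : (ZMod (n ^ 2))ˣ)) ^ (n * lam) = 1 := by
    subst hn hlam
    exact paillier_unit_pow p q hp hq hpq _
  have hR' : (((∏ i, (r i : ZMod (n ^ 2))) ^ n) ^ lam) = 1 := by
    have := congrArg (Units.val) hR
    push_cast at this
    rw [← pow_mul]
    exact this
  have hprod : (∏ i, paillierEnc n ((a i + γ i * c).val) (r i)) ^ lam =
      1 + (n : ZMod (n ^ 2)) * (((∑ i, (a i + γ i * c).val) * lam : ℕ)) := by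
    unfold paillierEnc
    rw [Finset.prod_mul_distrib, Finset.prod_pow_eq_pow_sum, Finset.prod_pow, mul_pow, hR',
      mul_one, ← pow_mul, paillier_one_add_pow]
  have hμ' : (μ : ZMod n) * lam = 1 := by
    have := (ZMod.natCast_eq_natCast_iff _ _ _).2 hμ
    push_cast at this
    exact this
  unfold paillierDec
  rw [hprod, paillier_val n _ hn1, ZMod.natCast_mod, Nat.cast_mul, ZMod.natCast_mod]
  push_cast
  simp only [ZMod.natCast_zmod_val]
  rw [Finset.sum_add_distrib, ← Finset.sum_mul, hγ]
  linear_combination (∑ i, a i + c) * hμ'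
end
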